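/- arXiv:0902.0648 — 3 statements merged into one kernel-verified Lean document; each statement's English description precedes it below -/
import Mathlib

section
/- Let T be a triangulated category (a pretriangulated category satisfying the octahedral axiom). Suppose given two distinguished triangles A →φ B →ψ C →ζ A[1] and A' →φ' B' →ψ' C' →ζ' A'[1], together with morphisms α : A → A', β : B → B', γ : C → C' forming a morphism of triangles, i.e. β∘φ = φ'∘α, γ∘ψ = ψ'∘β, and α[1]∘ζ = ζ'∘γ. Then there exist an object D, a distinguished triangle D → B'⊕C →η C' → D[1], where η is the morphism induced by −ψ' on B' and by γ on C, and a morphism δ : B → D such that, denoting by λ : D → C the composition of D → B'⊕C with the projection onto C, one has λ∘δ = ψ, and moreover: (1) α admits a left inverse (a morphism α' : A' → A with α'∘α = id_A) if and only if δ admits a left inverse δ' : D → B satisfying ψ∘δ' = λ; and (2) α is an isomorphism if and only if δ is an isomorphism. -/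
open CategoryTheory CategoryTheory.Limits CategoryTheory.Pretriangulated

section helpers

variable {𝒞 : Type*} [Category 𝒞] [Preadditive 𝒞] [HasZeroObject 𝒞]
    [HasShift 𝒞 ℤ] [∀ n : ℤ, (shiftFunctor 𝒞 n).Additive] [Pretriangulated 𝒞]

/-- Five lemma, middle, in unbundled form. -/
lemma aux_iso_mid {A B C A' B' : 𝒞} {f : A ⟶ B} {g : B ⟶ C} {h : C ⟶ A⟦(1 : ℤ)⟧}
    {f' : A' ⟶ B'} {g' : B' ⟶ C} {h' : C ⟶ A'⟦(1 : ℤ)⟧}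
    (hT : Triangle.mk f g h ∈ distTriang 𝒞) (hT' : Triangle.mk f' g' h' ∈ distTriang 𝒞)
    (a : A ⟶ A') (b : B ⟶ B') (h1 : f ≫ b = a ≫ f') (h2 : b ≫ g' = g)
    (h3 : h ≫ (shiftFunctor 𝒞 (1 : ℤ)).map a = h') : IsIso a ↔ IsIso b := by
  let F : Triangle.mk f g h ⟶ Triangle.mk f' g' h' :=
    Triangle.homMk _ _ a b (𝟙 C) h1 ((Category.comp_id g).trans h2.symm)
      (h3.trans (Category.id_comp h').symm)
  have hid : IsIso F.hom₃ := inferInstanceAs (IsIso (𝟙 C))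
  exact ⟨fun ha => isIso₂_of_isIso₁₃ F hT hT' ha hid,
    fun hb => isIso₁_of_isIso₂₃ F hT hT' hb hid⟩

/-- Completion of the middle morphism, with identity on the third objects. -/
lemma aux_complete_mid {A B C A' B' : 𝒞} {f : A ⟶ B} {g : B ⟶ C} {h : C ⟶ A⟦(1 : ℤ)⟧}
    {f' : A' ⟶ B'} {g' : B' ⟶ C} {h' : C ⟶ A'⟦(1 : ℤ)⟧}
    (hT : Triangle.mk f g h ∈ distTriang 𝒞) (hT' : Triangle.mk f' g' h' ∈ distTriang 𝒞)
    (a : A ⟶ A') (h3 : h ≫ (shiftFunctor 𝒞 (1 : ℤ)).map a = h') :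
    ∃ b : B ⟶ B', f ≫ b = a ≫ f' ∧ b ≫ g' = g := by
  obtain ⟨b, h1, h2⟩ := complete_distinguished_triangle_morphism₂ _ _ hT hT' a (𝟙 C)
    (h3.trans (Category.id_comp h').symm)
  exact ⟨b, h1, h2.symm.trans (Category.comp_id g)⟩

/-- Completion of the first morphism, with identity on the third objects. -/
lemma aux_complete_fst {A B C A' B' : 𝒞} {f : A ⟶ B} {g : B ⟶ C} {h : C ⟶ A⟦(1 : ℤ)⟧}
    {f' : A' ⟶ B'} {g' : B' ⟶ C} {h' : C ⟶ A'⟦(1 : ℤ)⟧}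
    (hT : Triangle.mk f g h ∈ distTriang 𝒞) (hT' : Triangle.mk f' g' h' ∈ distTriang 𝒞)
    (b : B ⟶ B') (h2 : b ≫ g' = g) :
    ∃ a : A ⟶ A', f ≫ b = a ≫ f' ∧ h ≫ (shiftFunctor 𝒞 (1 : ℤ)).map a = h' := by
  obtain ⟨a, h1, h3⟩ := complete_distinguished_triangle_morphism₁ _ _ hT hT' b (𝟙 C)
    ((Category.comp_id g).trans h2.symm)
  exact ⟨a, h1, h3.trans (Category.id_comp h')⟩

/-- The homotopy pullback is a fibre of the composite map. -/
lemma aux_pullback [IsTriangulated 𝒞] [HasBinaryBiproducts 𝒞] {A' B' C' C D : 𝒞}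
    {φ' : A' ⟶ B'} {ψ' : B' ⟶ C'} {ζ' : C' ⟶ A'⟦(1 : ℤ)⟧}
    (hT' : Triangle.mk φ' ψ' ζ' ∈ distTriang 𝒞) (γ : C ⟶ C')
    {ι : D ⟶ B' ⊞ C} {ρ : C' ⟶ D⟦(1 : ℤ)⟧}
    (hD : Triangle.mk ι (biprod.desc (-ψ') γ) ρ ∈ distTriang 𝒞) :
    ∃ μ : A' ⟶ D, Triangle.mk μ (ι ≫ biprod.snd) (γ ≫ ζ') ∈ distTriang 𝒞 := by
  have h12 : Triangle.mk (biprod.inl : B' ⟶ B' ⊞ C) biprod.snd 0 ∈ distTriang 𝒞 :=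
    binaryBiproductTriangle_distinguished B' C
  have h23 : Triangle.mk (biprod.desc (-ψ') γ) ρ
      (-(shiftFunctor 𝒞 (1 : ℤ)).map ι) ∈ distTriang 𝒞 := rot_of_distTriang _ hD
  have hr : Triangle.mk ψ' ζ' (-(shiftFunctor 𝒞 (1 : ℤ)).map φ') ∈ distTriang 𝒞 :=
    rot_of_distTriang _ hT'
  have h13 : Triangle.mk (-ψ') ζ' ((shiftFunctor 𝒞 (1 : ℤ)).map φ') ∈ distTriang 𝒞 := by
    refine isomorphic_distinguished _ hr _ (Triangle.isoMk _ _ (-Iso.refl B') (Iso.refl _)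
      (Iso.refl _) ?_ ?_ ?_)
    · change (-ψ') ≫ 𝟙 _ = (-𝟙 B') ≫ ψ'
      simp
    · change ζ' ≫ 𝟙 _ = 𝟙 _ ≫ ζ'
      simp
    · change (shiftFunctor 𝒞 (1 : ℤ)).map φ' ≫ (shiftFunctor 𝒞 (1 : ℤ)).map (-𝟙 B') =
        𝟙 _ ≫ (-(shiftFunctor 𝒞 (1 : ℤ)).map φ')
      simp
  have O := Triangulated.someOctahedron (biprod.inl_desc (-ψ') γ) h12 h23 h13
  have hm1 : O.m₁ = γ ≫ ζ' := by
    have := congrArg (fun t => biprod.inr ≫ t) O.comm₁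
    simpa using this
  have hmem := O.mem
  obtain ⟨μ, hμ⟩ := (shiftFunctor 𝒞 (1 : ℤ)).map_surjective O.m₃
  refine ⟨-μ, ?_⟩
  rw [rotate_distinguished_triangle, rotate_distinguished_triangle]
  have key : (Triangle.mk (-μ) (ι ≫ biprod.snd) (γ ≫ ζ')).rotate.rotate =
      Triangle.mk O.m₁ O.m₃
        ((-(shiftFunctor 𝒞 (1 : ℤ)).map ι) ≫ (shiftFunctor 𝒞 (1 : ℤ)).map biprod.snd) := by
    change Triangle.mk (γ ≫ ζ') (-(shiftFunctor 𝒞 (1 : ℤ)).map (-μ))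
      (-(shiftFunctor 𝒞 (1 : ℤ)).map (ι ≫ biprod.snd)) = _
    rw [hm1, ← hμ]
    simp
  rw [key]
  exact hmem

end helpers

/-- Lemma 2.1 (derived-category splitting lemma): given a morphism of distinguished
triangles `(α, β, γ)`, there is an object `D`, a distinguished triangle
`D → B' ⊞ C → C' → D[1]` (where the middle map is induced by `-ψ'` and `γ`) and a map
`δ : B → D` compatible with `ψ`, such that `α` has a left inverse iff `δ` does
(compatibly with `ψ`), and `α` is an isomorphism iff `δ` is. -/
theorem stmt0 {𝒞 : Type*} [Category 𝒞] [Preadditive 𝒞] [HasZeroObject 𝒞]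
    [HasShift 𝒞 ℤ] [∀ n : ℤ, (shiftFunctor 𝒞 n).Additive] [Pretriangulated 𝒞]
    [IsTriangulated 𝒞] [HasBinaryBiproducts 𝒞]
    {A B C A' B' C' : 𝒞}
    (φ : A ⟶ B) (ψ : B ⟶ C) (ζ : C ⟶ A⟦(1 : ℤ)⟧)
    (φ' : A' ⟶ B') (ψ' : B' ⟶ C') (ζ' : C' ⟶ A'⟦(1 : ℤ)⟧)
    (hT : Triangle.mk φ ψ ζ ∈ distTriang 𝒞)
    (hT' : Triangle.mk φ' ψ' ζ' ∈ distTriang 𝒞)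
    (α : A ⟶ A') (β : B ⟶ B') (γ : C ⟶ C')
    (comm1 : φ ≫ β = α ≫ φ')
    (comm2 : ψ ≫ γ = β ≫ ψ')
    (comm3 : ζ ≫ (shiftFunctor 𝒞 (1 : ℤ)).map α = γ ≫ ζ') :
    ∃ (D : 𝒞) (ι : D ⟶ B' ⊞ C) (ρ : C' ⟶ D⟦(1 : ℤ)⟧) (δ : B ⟶ D),
      (Triangle.mk ι (biprod.desc (-ψ') γ) ρ ∈ distTriang 𝒞) ∧
      δ ≫ ι ≫ biprod.snd = ψ ∧
      ((∃ α' : A' ⟶ A, α ≫ α' = 𝟙 A) ↔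
        ∃ δ' : D ⟶ B, δ ≫ δ' = 𝟙 B ∧ δ' ≫ ψ = ι ≫ biprod.snd) ∧
      (IsIso α ↔ IsIso δ) := by
  obtain ⟨D, ι, ρ, hD⟩ := distinguished_cocone_triangle₁ (biprod.desc (-ψ') γ)
  obtain ⟨μ, hμ⟩ := aux_pullback hT' γ hD
  obtain ⟨δ, hδ1, hδ2⟩ := aux_complete_mid hT hμ α comm3
  refine ⟨D, ι, ρ, δ, hD, hδ2, ⟨?_, ?_⟩, aux_iso_mid hT hμ α δ hδ1 hδ2 comm3⟩
  · rintro ⟨α', hα'⟩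
    have h3 : (γ ≫ ζ') ≫ (shiftFunctor 𝒞 (1 : ℤ)).map α' = ζ := by
      rw [← comm3, Category.assoc, ← Functor.map_comp, hα', CategoryTheory.Functor.map_id, Category.comp_id]
    obtain ⟨ε, hε1, hε2⟩ := aux_complete_mid hμ hT α' h3
    have hu : (δ ≫ ε) ≫ ψ = ψ := by rw [Category.assoc, hε2, hδ2]
    have hiso : IsIso (δ ≫ ε) := (aux_iso_mid hT hT (𝟙 A) (δ ≫ ε)
      (by rw [← Category.assoc, hδ1, Category.assoc, hε1, ← Category.assoc, hα']) hu
      (by rw [CategoryTheory.Functor.map_id, Category.comp_id])).1 inferInstance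
    refine ⟨ε ≫ inv (δ ≫ ε), by rw [← Category.assoc, IsIso.hom_inv_id], ?_⟩
    have hu' : inv (δ ≫ ε) ≫ ψ = ψ := by rw [IsIso.inv_comp_eq, hu]
    rw [Category.assoc, hu', hε2]
  · rintro ⟨δ', hδ', hδ'2⟩
    obtain ⟨ε, hε1, hε3⟩ := aux_complete_fst hμ hT δ' hδ'2
    have hiso : IsIso (α ≫ ε) := (aux_iso_mid hT hT (α ≫ ε) (𝟙 B)
      (by rw [Category.assoc, ← hε1, ← Category.assoc, ← hδ1, Category.assoc, hδ'])
      (Category.id_comp ψ)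
      (by rw [Functor.map_comp, ← Category.assoc, comm3, hε3])).2 inferInstance
    exact ⟨ε ≫ inv (α ≫ ε), by rw [← Category.assoc, IsIso.hom_inv_id]⟩
end

section
/- Let A ⊆ B be an extension of commutative rings with B integral over A. Let I be an ideal of A such that I·B = I, i.e. the extension of I to B is contained in A and equals I (I is simultaneously an ideal of B). Let J be a radical ideal of A with J ⊆ I. Then J·B ⊆ J; in particular J·B = J, so J is also an ideal of B. -/
/-- If `A ⊆ B` is an integral extension of commutative rings, `I` is an ideal of `A`
with `I·B = I` (i.e. the ideal of `B` generated by `I` coincides with the image of `I`),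
and `J ⊆ I` is a radical ideal of `A`, then `J·B = J`, i.e. `J` is also an ideal of `B`. -/
theorem stmt2 {A B : Type*} [CommRing A] [CommRing B] [Algebra A B]
    (hinj : Function.Injective (algebraMap A B))
    [Algebra.IsIntegral A B]
    (I : Ideal A)
    (hI : (Ideal.map (algebraMap A B) I : Set B) = (algebraMap A B) '' (I : Set A))
    (J : Ideal A) (hJrad : J.IsRadical) (hJI : J ≤ I) :
    (Ideal.map (algebraMap A B) J : Set B) = (algebraMap A B) '' (J : Set A) := by
  ext x
  constructor
  · intro hx
    have hxI : x ∈ (Ideal.map (algebraMap A B) I : Set B) := Ideal.map_mono hJI hx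
    rw [hI] at hxI
    obtain ⟨a, -, rfl⟩ := hxI
    refine ⟨a, ?_, rfl⟩
    apply hJrad
    rw [Ideal.radical_eq_sInf, Ideal.mem_sInf]
    rintro P ⟨hJP, hP⟩
    obtain ⟨Q, -, -, hQ⟩ := Ideal.exists_ideal_over_prime_of_isIntegral P (⊥ : Ideal B)
      (by
        rw [← RingHom.ker_eq_comap_bot, (RingHom.injective_iff_ker_eq_bot _).1 hinj]
        exact bot_le)
    have hJQ : Ideal.map (algebraMap A B) J ≤ Q := by
      rw [Ideal.map_le_iff_le_comap, hQ]
      exact hJP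
    rw [← hQ]
    exact hJQ hx
  · rintro ⟨a, ha, rfl⟩
    exact Ideal.mem_map_of_mem _ ha
end

section
/- Let A be an integrally closed (normal) Noetherian domain with fraction field K of characteristic 0, let L/K be a finite field extension, and let B be the integral closure of A in L. Let I be an ideal of A. Then for every element b ∈ √(I·B) (the radical in B of the ideal generated by I), the trace Tr_{L/K}(b) lies in √I, the radical of I in A. -/
/-- Let `A` be a Noetherian integrally closed domain with fraction field `K` of
characteristic `0`, `L/K` a finite field extension, `B` the integral closure of `A` in
`L`, and `I` an ideal of `A`. Then the trace of any element of `√(I·B)` lies in `√I`. -/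
theorem stmt4 (A K L : Type*) [CommRing A] [IsDomain A] [IsIntegrallyClosed A]
    [IsNoetherianRing A]
    [Field K] [Algebra A K] [IsFractionRing A K] [CharZero K]
    [Field L] [Algebra K L] [FiniteDimensional K L]
    [Algebra A L] [IsScalarTower A K L]
    (I : Ideal A)
    (b : integralClosure A L)
    (hb : b ∈ (Ideal.map (algebraMap A (integralClosure A L)) I).radical) :
    ∃ a ∈ I.radical, algebraMap A K a = Algebra.trace K L (b : L) := by
  obtain ⟨n, hn⟩ := hb
  have hn' : b ^ (n + 1) ∈ Ideal.map (algebraMap A (integralClosure A L)) I := by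
    rw [pow_succ]
    exact Ideal.mul_mem_right _ _ hn
  obtain ⟨f, hfm, hfa, hf⟩ :=
    Polynomial.exists_monic_aeval_eq_zero_forall_mem_of_mem_map hn'
  have hbi : IsIntegral A (b : L) := b.2
  have : FaithfulSMul A L := by
    rw [faithfulSMul_iff_algebraMap_injective, IsScalarTower.algebraMap_eq A K L]
    exact (algebraMap K L).injective.comp (IsFractionRing.injective A K)
  have hfa' : Polynomial.aeval (b : L) (Polynomial.expand A (n + 1) f) = 0 := by
    rw [Polynomial.expand_aeval]
    have h := congrArg (algebraMap (integralClosure A L) L) hfa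
    rw [← Polynomial.aeval_algebraMap_apply, map_zero, map_pow] at h
    exact h
  have hdvd := minpoly.isIntegrallyClosed_dvd hbi hfa'
  have hrad : ∀ i ≠ (minpoly A (b : L)).natDegree, (minpoly A (b : L)).coeff i ∈ I.radical := by
    intro i hi
    refine Ideal.radical_mono ?_ (Polynomial.coeff_mem_radical_span_coeff_of_dvd _ _
      (hfm.expand n.succ_pos) (minpoly.monic hbi) hdvd i hi)
    rw [Ideal.span_le]
    rintro _ ⟨j, hj, rfl⟩
    rw [Polynomial.natDegree_expand] at hj
    rw [Polynomial.coeff_expand n.succ_pos]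
    split_ifs with h
    · refine hf _ (ne_of_lt ?_)
      exact Nat.div_lt_of_lt_mul (by rwa [mul_comm] at hj)
    · exact I.zero_mem
  have hpos := minpoly.natDegree_pos hbi
  refine ⟨(Module.finrank (IntermediateField.adjoin K {(b : L)}) L : A) *
    -(minpoly A (b : L)).nextCoeff, ?_, ?_⟩
  · refine Ideal.mul_mem_left _ _ (neg_mem ?_)
    rw [Polynomial.nextCoeff_of_natDegree_pos hpos]
    exact hrad _ (by omega)
  · rw [trace_eq_finrank_mul_minpoly_nextCoeff, minpoly.isIntegrallyClosed_eq_field_fractions' K hbi,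
      Polynomial.nextCoeff_map (IsFractionRing.injective A K)]
    simp
end
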